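/- arXiv:1010.5681 — 3 statements merged into one kernel-verified Lean document; each statement's English description precedes it below -/
import Mathlib

section
/- Let k ≥ 1 and let P, L be complex k×k matrices with P symmetric and L skew-Hermitian. If the pair (P,L) is strongly ℂ-linearly convex, then the 2k×2k block matrix A(P,L) = [[P, L], [Lᵀ, −P̄]] is invertible. -/
open Matrix

/-- The block matrix `A(P,L) = [[P, L], [Lᵀ, −P̄]]`. -/
def blockA {k : ℕ} (P L : Matrix (Fin k) (Fin k) ℂ) :
    Matrix (Fin k ⊕ Fin k) (Fin k ⊕ Fin k) ℂ :=
  Matrix.fromBlocks P L Lᵀ (-(P.map (starRingEnd ℂ)))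

/-- For `L` skew-Hermitian, the values of the form `zᵀLz̄` are purely imaginary. -/
theorem star_dotProduct_mulVec_star_of_skewHermitian {k : ℕ} {L : Matrix (Fin k) (Fin k) ℂ}
    (hL : Lᴴ = -L) (z : Fin k → ℂ) :
    star (z ⬝ᵥ L *ᵥ star z) = -(z ⬝ᵥ L *ᵥ star z) := by
  rw [← star_dotProduct_star, star_mulVec, star_star, hL, vecMul_neg, neg_dotProduct,
    ← dotProduct_mulVec]

/-- A solution of the antilinear equation `Pz = -Lz̄` is a zero of the strong
ℂ-linear convexity form. -/
theorem sclc_form_eq_zero {k : ℕ} {P L : Matrix (Fin k) (Fin k) ℂ} (hL : Lᴴ = -L)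
    {z : Fin k → ℂ} (hz : P *ᵥ z = -(L *ᵥ star z)) :
    -(((z ⬝ᵥ P *ᵥ z).im : ℂ)) + Complex.I * (z ⬝ᵥ L *ᵥ star z) = 0 := by
  have h := congrArg Complex.re (star_dotProduct_mulVec_star_of_skewHermitian hL z)
  rw [hz, dotProduct_neg]
  generalize z ⬝ᵥ L *ᵥ star z = t at h ⊢
  simp only [Complex.star_def, Complex.conj_re, Complex.neg_re] at h
  apply Complex.ext <;> simp
  linarith

/-- If the pair `(P,L)` (with `P` symmetric, `L` skew-Hermitian) is strongly
ℂ-linearly convex, then the block matrix `A(P,L)` is invertible. -/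
theorem sclc_blockA_isUnit {k : ℕ} (hk : 1 ≤ k) (P L : Matrix (Fin k) (Fin k) ℂ)
    (hP : Pᵀ = P) (hL : Lᴴ = -L)
    (hsclc : ∀ z : Fin k → ℂ, z ≠ 0 →
        -(((dotProduct z (P.mulVec z)).im : ℂ))
          + Complex.I * dotProduct z (L.mulVec (star z)) ≠ 0) :
    IsUnit (blockA P L) := by
  have hzero : ∀ z : Fin k → ℂ, P *ᵥ z = -(L *ᵥ star z) → z = 0 := fun z hz ↦ by
    by_contra hne
    exact hsclc z hne (sclc_form_eq_zero hL hz)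
  rw [← mulVec_injective_iff_isUnit]
  refine (injective_iff_map_eq_zero (blockA P L).mulVecLin).2 fun x hx ↦ ?_
  obtain ⟨u, v, rfl⟩ : ∃ u v : Fin k → ℂ, x = Sum.elim u v :=
    ⟨x ∘ Sum.inl, x ∘ Sum.inr, (Sum.elim_comp_inl_inr x).symm⟩
  rw [mulVecLin_apply, blockA, fromBlocks_mulVec] at hx
  have h₁ : P *ᵥ u = -(L *ᵥ v) :=
    eq_neg_of_add_eq_zero_left (funext fun i ↦ congrFun hx (Sum.inl i))
  have h₂ : P *ᵥ star v = -(L *ᵥ star u) := by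
    have h : Lᵀ *ᵥ u + -(P.map (starRingEnd ℂ)) *ᵥ v = 0 :=
      funext fun i ↦ congrFun hx (Sum.inr i)
    have hPv : star (P.map (starRingEnd ℂ) *ᵥ v) = P *ᵥ star v := by
      ext i
      simp [mulVec, dotProduct]
    have hLu : star (Lᵀ *ᵥ u) = -(L *ᵥ star u) := by
      rw [← neg_mulVec, ← hL]
      ext i
      simp [mulVec, dotProduct]
    rw [neg_mulVec, ← sub_eq_add_neg, sub_eq_zero] at h
    rw [← hPv, ← h, hLu]
  have hs : u + star v = 0 := hzero _ (by
    rw [mulVec_add, h₁, h₂, star_add, star_star, mulVec_add]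
    abel)
  have hd : Complex.I • (u - star v) = 0 := hzero _ (by
    rw [mulVec_smul, mulVec_sub, h₁, h₂, star_smul, star_sub, star_star, mulVec_smul, mulVec_sub,
      Complex.star_def, Complex.conj_I]
    module)
  have huv : u = star v := sub_eq_zero.1 ((smul_eq_zero.1 hd).resolve_left Complex.I_ne_zero)
  have hu : u = 0 := by
    rw [← huv, ← two_smul ℂ] at hs
    exact (smul_eq_zero.1 hs).resolve_left two_ne_zero
  have hv : v = 0 := star_eq_zero.1 (huv.symm.trans hu)
  rw [hu, hv, Sum.elim_zero_zero]
end

section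
/- Let k ≥ 1 and let P, L be complex k×k matrices with P symmetric and L skew-Hermitian. Assume L, P·conj(L⁻¹P) − L, and P̄·L⁻¹·P − L̄ are all invertible, and set Q = conj(L⁻¹P)·(P·conj(L⁻¹P) − L)⁻¹ and M = (P̄·L⁻¹·P − L̄)⁻¹. Then the block matrix [[Q, M], [Mᵀ, −Q̄]] is the inverse of A(P,L) = [[P, L], [Lᵀ, −P̄]], i.e. [[P, L], [Lᵀ, −P̄]] · [[Q, M], [Mᵀ, −Q̄]] = I_{2k}. -/
open Matrix

/-- Entrywise complex conjugate of a matrix. -/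
def mconj {k : ℕ} (X : Matrix (Fin k) (Fin k) ℂ) : Matrix (Fin k) (Fin k) ℂ :=
  X.map (starRingEnd ℂ)

theorem mconj_mul {k : ℕ} (X Y : Matrix (Fin k) (Fin k) ℂ) :
    mconj (X * Y) = mconj X * mconj Y :=
  Matrix.map_mul

theorem mconj_sub {k : ℕ} (X Y : Matrix (Fin k) (Fin k) ℂ) :
    mconj (X - Y) = mconj X - mconj Y := by
  ext i j
  simp [mconj]

theorem mconj_mconj {k : ℕ} (X : Matrix (Fin k) (Fin k) ℂ) : mconj (mconj X) = X := by
  ext i j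
  simp [mconj]

theorem mconj_eq_conjTranspose_transpose {k : ℕ} (X : Matrix (Fin k) (Fin k) ℂ) :
    mconj X = Xᴴᵀ := by
  ext i j
  simp [mconj]

theorem mconj_inv {k : ℕ} (X : Matrix (Fin k) (Fin k) ℂ) : mconj X⁻¹ = (mconj X)⁻¹ := by
  simp only [mconj_eq_conjTranspose_transpose, conjTranspose_nonsing_inv, transpose_nonsing_inv]

theorem inv_neg_of_isUnit_det {k : ℕ} {X : Matrix (Fin k) (Fin k) ℂ} (hX : IsUnit X.det) :
    (-X)⁻¹ = -X⁻¹ :=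
  inv_eq_right_inv (by rw [neg_mul_neg, mul_nonsing_inv _ hX])

/-- Explicit block inverse of `A(P,L) = [[P, L], [Lᵀ, −P̄]]`: with
`Q = conj(L⁻¹P)·(P·conj(L⁻¹P) − L)⁻¹` and `M = (P̄·L⁻¹·P − L̄)⁻¹`, one has
`[[P, L], [Lᵀ, −P̄]] · [[Q, M], [Mᵀ, −Q̄]] = I`. -/
theorem blockA_explicit_inverse {k : ℕ} (hk : 1 ≤ k) (P L : Matrix (Fin k) (Fin k) ℂ)
    (hP : Pᵀ = P) (hL : Lᴴ = -L)
    (hLinv : IsUnit L)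
    (h1 : IsUnit (P * mconj (L⁻¹ * P) - L))
    (h2 : IsUnit (mconj P * L⁻¹ * P - mconj L)) :
    Matrix.fromBlocks P L Lᵀ (-(mconj P))
        * Matrix.fromBlocks (mconj (L⁻¹ * P) * (P * mconj (L⁻¹ * P) - L)⁻¹)
            ((mconj P * L⁻¹ * P - mconj L)⁻¹)
            ((mconj P * L⁻¹ * P - mconj L)⁻¹)ᵀ
            (-(mconj (mconj (L⁻¹ * P) * (P * mconj (L⁻¹ * P) - L)⁻¹)))
      = 1 := by
  have hLt : Lᵀ = -mconj L := by
    rw [mconj_eq_conjTranspose_transpose, hL, transpose_neg, neg_neg]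
  have hlt : (mconj L)ᵀ = -L := by
    rw [mconj_eq_conjTranspose_transpose, transpose_transpose, hL]
  have hpt : (mconj P)ᵀ = mconj P := by
    ext i j
    simpa [mconj] using congrArg (starRingEnd ℂ) (congrFun (congrFun hP i) j)
  have hL' : IsUnit L.det := (isUnit_iff_isUnit_det L).mp hLinv
  have hl' : IsUnit (mconj L).det := by
    rw [← neg_neg (mconj L), ← hLt, det_neg, det_transpose]
    exact ((isUnit_one.neg).pow _).mul hL'
  have hM : ((mconj P * L⁻¹ * P - mconj L)⁻¹)ᵀ = -(P * mconj (L⁻¹ * P) - L)⁻¹ := by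
    have hneg : (mconj P * L⁻¹ * P - mconj L)ᵀ = -(P * mconj (L⁻¹ * P) - L) := by
      simp only [transpose_sub, transpose_mul, transpose_nonsing_inv, hP, hpt, hlt, hLt,
        mconj_mul, mconj_inv, inv_neg_of_isUnit_det hl']
      noncomm_ring
    rw [transpose_nonsing_inv, hneg,
      inv_neg_of_isUnit_det ((isUnit_iff_isUnit_det _).mp h1)]
  have hQ : mconj (mconj (L⁻¹ * P) * (P * mconj (L⁻¹ * P) - L)⁻¹)
      = L⁻¹ * P * (mconj P * L⁻¹ * P - mconj L)⁻¹ := by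
    simp only [mconj_mul, mconj_inv, mconj_sub, mconj_mconj, Matrix.mul_assoc]
  have hS := mul_nonsing_inv _ ((isUnit_iff_isUnit_det _).mp h1)
  have hT := mul_nonsing_inv _ ((isUnit_iff_isUnit_det _).mp h2)
  rw [hM, hQ, hLt, fromBlocks_multiply, ← fromBlocks_one]
  congr 1
  · rw [← hS]
    noncomm_ring
  · rw [Matrix.mul_neg, Matrix.mul_assoc L⁻¹, mul_nonsing_inv_cancel_left _ _ hL', add_neg_cancel]
  · rw [mconj_mul, mconj_inv, Matrix.neg_mul, Matrix.mul_assoc (mconj L)⁻¹,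
      mul_nonsing_inv_cancel_left _ _ hl', neg_mul_neg, neg_add_cancel]
  · rw [← hT]
    noncomm_ring
end

section
/- Duality preserves strong ℂ-linear convexity (matrix form of the key step in the duality lemma): Let k ≥ 1 and let P, L be complex k×k matrices with P symmetric and L skew-Hermitian, such that the pair (P,L) is strongly ℂ-linearly convex and the block matrix A(P,L) = [[P, L], [Lᵀ, −P̄]] is invertible with inverse A(P,L)⁻¹ = [[Q, M], [Mᵀ, −Q̄]], where Qᵀ = Q and M̄ᵀ = −M. Then the pair (Q, −M) is also strongly ℂ-linearly convex; equivalently, for every nonzero w ∈ ℂ^k, i·(wᵀ, w̄ᵀ)·[[Q, −M], [M̄, −Q̄]]·(w; w̄) ≠ 0. -/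
open Matrix

/-- Entrywise conjugation commutes with the action of a matrix on a vector. -/
theorem map_conj_mulVec_star {k : ℕ} (P : Matrix (Fin k) (Fin k) ℂ) (z : Fin k → ℂ) :
    (P.map (starRingEnd ℂ)).mulVec (star z) = star (P.mulVec z) := by
  ext i
  simp [Matrix.mulVec, dotProduct]

/-- The vector `(z; z̄)` is sent by `A(P,L)` to `(Pz + Lz̄; Lᵀz − P̄z̄)`. -/
theorem blockA_mulVec_elim_star {k : ℕ} (P L : Matrix (Fin k) (Fin k) ℂ) (z : Fin k → ℂ) :
    (blockA P L).mulVec (Sum.elim z (star z)) =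
      Sum.elim (P.mulVec z + L.mulVec (star z)) (Lᵀ.mulVec z - star (P.mulVec z)) := by
  rw [blockA, Matrix.fromBlocks_mulVec]
  simp [Matrix.neg_mulVec, map_conj_mulVec_star, sub_eq_add_neg]

/-- The complex quadratic form of `i·A(P,L)` at `(z; z̄)` is twice the convexity form. -/
theorem I_mul_dotProduct_blockA {k : ℕ} (P L : Matrix (Fin k) (Fin k) ℂ) (z : Fin k → ℂ) :
    Complex.I * dotProduct (Sum.elim z (star z)) ((blockA P L).mulVec (Sum.elim z (star z))) =
      2 * (-(((dotProduct z (P.mulVec z)).im : ℂ))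
        + Complex.I * dotProduct z (L.mulVec (star z))) := by
  have hL : dotProduct (star z) (Lᵀ.mulVec z) = dotProduct z (L.mulVec (star z)) := by
    rw [Matrix.mulVec_transpose, dotProduct_comm, Matrix.dotProduct_mulVec]
  have hP : dotProduct (star z) (star (P.mulVec z)) =
      (starRingEnd ℂ) (dotProduct z (P.mulVec z)) := by
    simp [dotProduct]
  have him := Complex.sub_conj (dotProduct z (P.mulVec z))
  rw [blockA_mulVec_elim_star, sumElim_dotProduct_sumElim, dotProduct_add, dotProduct_sub, hL, hP]
  push_cast at him
  linear_combination Complex.I * him +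
    2 * ((dotProduct z (P.mulVec z)).im : ℂ) * Complex.I_mul_I

/-- **Duality preserves strong ℂ-linear convexity.**  If `(P,L)` is strongly
ℂ-linearly convex (with `P` symmetric and `L` skew-Hermitian) and
`A(P,L)⁻¹ = [[Q, M], [Mᵀ, −Q̄]]` with `Q` symmetric and `M` skew-Hermitian,
then the pair `(Q, −M)` is also strongly ℂ-linearly convex; equivalently, for
every nonzero `w`, `i·(wᵀ, w̄ᵀ)·A(Q,−M)·(w; w̄) ≠ 0`. -/
theorem dual_sclc {k : ℕ} (hk : 1 ≤ k) (P L Q M : Matrix (Fin k) (Fin k) ℂ)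
    (hP : Pᵀ = P) (hL : Lᴴ = -L) (hQ : Qᵀ = Q) (hM : Mᴴ = -M)
    (hsclc : ∀ z : Fin k → ℂ, z ≠ 0 →
        -(((dotProduct z (P.mulVec z)).im : ℂ))
          + Complex.I * dotProduct z (L.mulVec (star z)) ≠ 0)
    (hA : IsUnit (blockA P L))
    (hinv : (blockA P L)⁻¹ = Matrix.fromBlocks Q M Mᵀ (-(Q.map (starRingEnd ℂ)))) :
    (∀ w : Fin k → ℂ, w ≠ 0 →
        -(((dotProduct w (Q.mulVec w)).im : ℂ))
          + Complex.I * dotProduct w ((-M).mulVec (star w)) ≠ 0) ∧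
    (∀ w : Fin k → ℂ, w ≠ 0 →
        Complex.I * dotProduct (Sum.elim w (star w))
          ((blockA Q (-M)).mulVec (Sum.elim w (star w))) ≠ 0) := by
  have hquad : ∀ w : Fin k → ℂ, w ≠ 0 →
      Complex.I * dotProduct (Sum.elim w (star w))
        ((blockA Q (-M)).mulVec (Sum.elim w (star w))) ≠ 0 := by
    intro w hw
    set z : Fin k → ℂ := Q.mulVec w - M.mulVec (star w) with hz
    have hMz : star (M.mulVec (star w)) = -(Mᵀ.mulVec w) := by
      rw [Matrix.star_mulVec, star_star, hM, Matrix.vecMul_neg, Matrix.mulVec_transpose]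
    have hdual : (blockA Q (-M)).mulVec (Sum.elim w (star w)) = Sum.elim z (-star z) := by
      rw [blockA_mulVec_elim_star, hz, star_sub, hMz, Matrix.transpose_neg, Matrix.neg_mulVec,
        Matrix.neg_mulVec]
      congr 1
      abel
    have hpre : (blockA P L)⁻¹.mulVec (Sum.elim w (-star w)) = Sum.elim z (star z) := by
      rw [hinv, Matrix.fromBlocks_mulVec, hz, star_sub, hMz]
      simp [Matrix.neg_mulVec, Matrix.mulVec_neg, map_conj_mulVec_star, sub_eq_add_neg,
        add_comm]
    have himg : (blockA P L).mulVec (Sum.elim z (star z)) = Sum.elim w (-star w) := by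
      rw [← hpre, Matrix.mulVec_mulVec,
        Matrix.mul_nonsing_inv _ ((Matrix.isUnit_iff_isUnit_det _).mp hA), Matrix.one_mulVec]
    have hz0 : z ≠ 0 := by
      intro h
      apply hw
      rw [h, star_zero, Sum.elim_zero_zero, Matrix.mulVec_zero] at himg
      funext i
      simpa using (congrFun himg (Sum.inl i)).symm
    have hform := I_mul_dotProduct_blockA P L z
    rw [himg, sumElim_dotProduct_sumElim, dotProduct_comm z, dotProduct_neg,
      dotProduct_comm (star z), ← dotProduct_neg] at hform
    rw [hdual, sumElim_dotProduct_sumElim, hform]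
    exact mul_ne_zero two_ne_zero (hsclc z hz0)
  refine ⟨fun w hw h => hquad w hw ?_, hquad⟩
  rw [I_mul_dotProduct_blockA, h, mul_zero]
end
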